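/- arXiv:2411.14455 — 2 statements merged into one kernel-verified Lean document; each statement's English description precedes it below -/
import Mathlib

section
/- (Herglotz representation theorem) Let f be a holomorphic function on the open unit disc 𝔻 with Re f(z) ≥ 0 for all z ∈ 𝔻. Then there exists a unique finite positive Borel measure μ on the unit circle 𝕋 such that f(z) = i·Im f(0) + ∫_𝕋 (α + z)/(α − z) dμ(α) for all z ∈ 𝔻. Moreover, if f(0) = 1 then μ is a probability measure on 𝕋. -/
open scoped ComplexOrder
open ContinuousLinearMap MeasureTheory

noncomputable section

/-- The Borel σ-algebra on the unit circle `𝕋`. -/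
instance : MeasurableSpace Circle := borel Circle

instance : BorelSpace Circle := ⟨rfl⟩

section Aux
open Complex Metric Filter Topology

lemma hk_ne {α : Circle} {z : ℂ} (hz : z ∈ ball (0:ℂ) 1) : (α : ℂ) - z ≠ 0 := by
  intro h
  have : (α : ℂ) = z := sub_eq_zero.mp h
  have h1 : ‖z‖ = 1 := by rw [← this]; exact Circle.norm_coe α
  simp at hz
  linarith

lemma hk_cont {z : ℂ} (hz : z ∈ ball (0:ℂ) 1) :
    Continuous (fun α : Circle => ((α : ℂ) + z) / ((α : ℂ) - z)) :=
  Continuous.div (by fun_prop) (by fun_prop) (fun _ => hk_ne hz)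

lemma circ_integrable {E : Type*} [NormedAddCommGroup E] (μ : Measure Circle) [IsFiniteMeasure μ] {φ : Circle → E}
    (h : Continuous φ) : Integrable φ μ :=
  h.integrable_of_hasCompactSupport (HasCompactSupport.of_compactSpace _)

lemma approx (g : ℂ → ℂ) (hg : DifferentiableOn ℂ g (closedBall 0 1))
    (hre : ∀ z ∈ closedBall (0:ℂ) 1, 0 ≤ (g z).re) :
    ∃ μ : Measure Circle, IsFiniteMeasure μ ∧
      ∀ z ∈ ball (0:ℂ) 1, g z = I * (g 0).im + ∫ α : Circle, ((α : ℂ) + z) / ((α : ℂ) - z) ∂μ := by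
  have hmap : ∀ θ : ℝ, circleMap 0 1 θ ∈ closedBall (0:ℂ) 1 := fun θ => by simp
  have hgc : Continuous (fun θ : ℝ => g (circleMap 0 1 θ)) :=
    hg.continuousOn.comp_continuous (continuous_circleMap 0 1) hmap
  have huc : Continuous (fun θ : ℝ => (g (circleMap 0 1 θ)).re) := continuous_re.comp hgc
  have hcl : DiffContOnCl ℂ g (ball 0 1) := by
    apply DifferentiableOn.diffContOnCl
    rwa [closure_ball _ one_ne_zero]
  have hgI : CircleIntegrable g 0 1 := hgc.intervalIntegrable _ _
  have huI : CircleIntegrable (fun z => (g z).re) 0 1 := huc.intervalIntegrable _ _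
  have huI' : CircleIntegrable (fun z => (((g z).re : ℝ) : ℂ)) 0 1 :=
    (continuous_ofReal.comp huc).intervalIntegrable _ _
  set H : ℂ → ℂ := fun w ↦ Real.circleAverage
    (fun ζ ↦ herglotzRieszKernel 0 w ζ • (((g ζ).re : ℝ) : ℂ)) 0 1 with hH
  have hHan : AnalyticOnNhd ℂ H (ball 0 1) :=
    analyticOnNhd_circleAverage_herglotzRieszKernel_smul huI'
  have hHre : ∀ w ∈ ball (0:ℂ) 1, (H w).re = (g w).re := by
    intro w hw
    rw [hH]
    simp only
    rw [re_circleAverage_herglotzRieszKernel_smul huI hw]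
    conv_rhs => rw [← hcl.circleAverage_re_herglotzRieszKernel_smul hw]
    have := reCLM.circleAverage_comp_comm (c := 0) (R := 1)
      (f := (re ∘ herglotzRieszKernel 0 w) • g) ?_
    · rw [reCLM_apply] at this
      rw [← this]
      congr 1
      ext x
      simp
    · apply hgI.continuousOn_smul
      exact continuous_re.comp_continuousOn (continuousOn_herglotzRieszKernel_sphere hw)
  have h0 : (0:ℂ) ∈ ball (0:ℂ) 1 := by simp
  have hH0 : H 0 = ((g 0).re : ℂ) := by
    have e : H 0 = ((Real.circleAverage (fun z => (g z).re) 0 1 : ℝ) : ℂ) := by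
      have h2 := ofRealCLM.circleAverage_comp_comm huI
      rw [ofRealCLM_apply] at h2
      rw [← h2]
      apply Real.circleAverage_congr_sphere
      intro x hx
      have : x ≠ 0 := by rintro rfl; simp at hx
      simp [herglotzRieszKernel_def, this]
    have h3 := hHre 0 h0
    rw [e] at h3 ⊢
    rw [← h3]; simp
  have hgan : AnalyticOnNhd ℂ g (ball 0 1) :=
    (hg.mono ball_subset_closedBall).analyticOnNhd isOpen_ball
  have hkey : ∀ w ∈ ball (0:ℂ) 1, g w = I * (g 0).im + H w := by
    obtain ⟨c, hc⟩ := (hgan.sub hHan).eq_const_of_re_eq_const (c₀ := 0)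
      (fun w hw => by simp [hHre w hw]) isOpen_ball ((convex_ball _ _).isConnected ⟨0, h0⟩)
    intro w hw
    have h1 := hc w hw
    have h2 := hc 0 h0
    rw [← h2] at h1
    simp only [Pi.sub_apply, hH0] at h1
    have h3 := re_add_im (g 0)
    linear_combination h1 - h3
  set d : ℝ → ℝ := fun θ => (2 * Real.pi)⁻¹ * (g (circleMap 0 1 θ)).re with hd
  have hdc : Continuous d := continuous_const.mul huc
  have hd0 : ∀ θ, 0 ≤ d θ := fun θ => mul_nonneg (by positivity) (hre _ (hmap θ))
  set ρ := ((volume.restrict (Set.Ioc 0 (2 * Real.pi))).withDensity (fun θ => ENNReal.ofReal (d θ)))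
    with hρ
  have hρf : IsFiniteMeasure ρ := by
    apply isFiniteMeasure_withDensity_ofReal
    exact ((hdc.integrableOn_Icc (a := 0) (b := 2 * Real.pi)).mono_set Set.Ioc_subset_Icc_self).2
  refine ⟨ρ.map Circle.exp, inferInstance, fun w hw => ?_⟩
  rw [hkey w hw]
  congr 1
  rw [integral_map (by fun_prop) (hk_cont hw).aestronglyMeasurable, hρ,
    integral_withDensity_eq_integral_toReal_smul (by fun_prop) (by simp), hH]
  simp only
  rw [Real.circleAverage_def, intervalIntegral.integral_of_le (by positivity), ← integral_smul]
  congr 1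
  ext θ
  rw [ENNReal.toReal_ofReal (hd0 θ)]
  simp [herglotzRieszKernel_def, hd, circleMap]
  ring

lemma mass_eq (f : ℂ → ℂ) (μ : Measure Circle) [IsFiniteMeasure μ]
    (h : ∀ z ∈ ball (0 : ℂ) 1,
        f z = I * (f 0).im + ∫ α : Circle, ((α : ℂ) + z) / ((α : ℂ) - z) ∂μ) :
    μ.real Set.univ = (f 0).re := by
  have := h 0 (by simp)
  apply_fun re at this
  simp at this
  exact this.symm

lemma exists_repr (f : ℂ → ℂ) (hf : DifferentiableOn ℂ f (ball 0 1))
    (hre : ∀ z ∈ ball (0 : ℂ) 1, 0 ≤ (f z).re) :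
    ∃ μ : Measure Circle, IsFiniteMeasure μ ∧
      (∀ z ∈ ball (0 : ℂ) 1,
        f z = I * (f 0).im + ∫ α : Circle, ((α : ℂ) + z) / ((α : ℂ) - z) ∂μ) := by
  set r : ℕ → ℝ := fun n => 1 - 1 / ((n:ℝ) + 1) with hr
  have hr0 : ∀ n, 0 ≤ r n := fun n => by
    simp only [hr, sub_nonneg]
    rw [div_le_one (by positivity)]; simp
  have hr1 : ∀ n, r n < 1 := fun n => by simp only [hr]; linarith [Nat.one_div_pos_of_nat (α := ℝ) (n := n)]
  have hrt : Tendsto r atTop (𝓝 1) := by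
    have := (tendsto_one_div_add_atTop_nhds_zero_nat (𝕜 := ℝ)).const_sub 1
    rwa [sub_zero] at this
  have hmem : ∀ n, ∀ z ∈ closedBall (0:ℂ) 1, (r n : ℂ) * z ∈ ball (0:ℂ) 1 := by
    intro n z hz
    simp only [mem_closedBall, dist_zero_right, mem_ball, norm_mul, norm_real, Real.norm_eq_abs,
      abs_of_nonneg (hr0 n)] at hz ⊢
    nlinarith [hr0 n, hr1 n, norm_nonneg z]
  have hex := fun n => approx (fun z => f (r n * z))
    (hf.comp (by fun_prop) (fun z hz => hmem n z hz)) (fun z hz => hre _ (hmem n z hz))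
  choose μ hμf hμ using hex
  simp only [mul_zero] at hμ
  let M : ℕ → FiniteMeasure Circle := fun n => ⟨μ n, hμf n⟩
  have hmass : ∀ n, (M n).mass ≤ Real.toNNReal (f 0).re := by
    intro n
    have := mass_eq (fun z => f (r n * z)) (μ n) (by simpa using hμ n)
    simp only [mul_zero] at this
    rw [← this]
    apply le_of_eq
    simp [FiniteMeasure.mass, M, Measure.real, ENNReal.toNNReal]
  have hcomp := isCompact_setOfPred_finiteMeasure_le_of_compactSpace Circle (Real.toNNReal (f 0).re)
  obtain ⟨L, -, hL⟩ := hcomp.ultrafilter_le_nhds' (((hyperfilter ℕ).map M))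
    (by rw [Ultrafilter.mem_map]; exact Filter.univ_mem' hmass)
  have hT : Tendsto M (hyperfilter ℕ : Filter ℕ) (𝓝 L) := hL
  refine ⟨L, inferInstance, fun z hz => ?_⟩
  have h1 := (FiniteMeasure.tendsto_iff_forall_integral_rclike_tendsto ℂ).1 hT
    (BoundedContinuousFunction.mkOfCompact ⟨_, hk_cont hz⟩)
  simp only [BoundedContinuousFunction.mkOfCompact_apply, ContinuousMap.coe_mk] at h1
  have hle : (hyperfilter ℕ : Filter ℕ) ≤ atTop := by
    rw [← Nat.cofinite_eq_atTop]; exact hyperfilter_le_cofinite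
  have h2 : Tendsto (fun n => f (r n * z)) (hyperfilter ℕ : Filter ℕ) (𝓝 (f z)) := by
    have hc : ContinuousAt f z := (hf.differentiableAt (isOpen_ball.mem_nhds hz)).continuousAt
    have : Tendsto (fun n => (r n : ℂ) * z) atTop (𝓝 z) := by
      simpa using ((continuous_ofReal.tendsto 1).comp hrt).mul_const z
    exact (hc.tendsto.comp this).mono_left hle
  have h3 := h1.const_add (I * (f 0).im)
  refine tendsto_nhds_unique h2 (h3.congr fun n => ?_)
  exact (hμ n z hz).symm

lemma hasSum_aux (μ : Measure Circle) [IsFiniteMeasure μ] {z : ℂ} (hz : z ∈ ball (0:ℂ) 1) :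
    HasSum (fun n : ℕ => z ^ n • ∫ α : Circle, ((α : ℂ)⁻¹) ^ n ∂μ)
      (∫ α : Circle, (α : ℂ) / ((α : ℂ) - z) ∂μ) := by
  have hz' : ‖z‖ < 1 := by simpa using hz
  have hc : ∀ n : ℕ, Continuous (fun α : Circle => z ^ n * ((α : ℂ)⁻¹) ^ n) := fun n =>
    continuous_const.mul ((Continuous.inv₀ (by fun_prop) (fun α => Circle.coe_ne_zero α)).pow n)
  have := hasSum_integral_of_dominated_convergence (μ := μ)
    (F := fun (n:ℕ) (α : Circle) => z ^ n * ((α : ℂ)⁻¹) ^ n)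
    (f := fun α : Circle => (α : ℂ) / ((α : ℂ) - z))
    (fun n _ => ‖z‖ ^ n) (fun n => (hc n).aestronglyMeasurable)
    (fun n => ae_of_all _ fun α => by
      rw [norm_mul, norm_pow, norm_pow, norm_inv, Circle.norm_coe]; simp)
    (ae_of_all _ fun α => summable_geometric_of_lt_one (norm_nonneg z) hz')
    (integrable_const _)
    (ae_of_all _ fun α => by
      have h := hasSum_geometric_of_norm_lt_one (ξ := z * (α:ℂ)⁻¹) (by
        rw [norm_mul, norm_inv, Circle.norm_coe]; simpa using hz')
      have e : (1 - z * (α:ℂ)⁻¹)⁻¹ = (α : ℂ) / ((α : ℂ) - z) := by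
        have h1 := hk_ne (α := α) hz
        have h2 := Circle.coe_ne_zero α
        rw [inv_eq_one_div, ← div_eq_mul_inv, one_sub_div h2]
        field_simp
      rw [e] at h
      simpa [mul_pow] using h)
  simpa [integral_const_mul] using this

lemma moments (μ ν : Measure Circle) [IsFiniteMeasure μ] [IsFiniteMeasure ν]
    (h : ∀ z ∈ ball (0:ℂ) 1, ∫ α : Circle, ((α : ℂ) + z) / ((α : ℂ) - z) ∂μ =
      ∫ α : Circle, ((α : ℂ) + z) / ((α : ℂ) - z) ∂ν) (n : ℕ) :
    ∫ α : Circle, ((α : ℂ)⁻¹) ^ n ∂μ = ∫ α : Circle, ((α : ℂ)⁻¹) ^ n ∂ν := by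
  have key : ∀ (μ : Measure Circle) [IsFiniteMeasure μ], ∀ z ∈ ball (0:ℂ) 1,
      ∫ α : Circle, (α : ℂ) / ((α : ℂ) - z) ∂μ =
      (1/2) * (∫ α : Circle, ((α : ℂ) + z) / ((α : ℂ) - z) ∂μ + 
        ∫ α : Circle, ((α : ℂ) + 0) / ((α : ℂ) - 0) ∂μ) := by
    intro μ _ z hz
    rw [← integral_add (circ_integrable μ (hk_cont hz)) (circ_integrable μ (hk_cont (by simp))),
      ← integral_const_mul]
    congr 1
    ext α
    have h1 := hk_ne (α := α) hz
    have h2 := Circle.coe_ne_zero α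
    simp only [add_zero, sub_zero, div_self h2]
    field_simp
    ring
  have hps : ∀ (μ : Measure Circle) [IsFiniteMeasure μ],
      HasFPowerSeriesAt (fun z => ∫ α : Circle, (α : ℂ) / ((α : ℂ) - z) ∂μ)
        (FormalMultilinearSeries.ofScalars ℂ (fun n : ℕ => ∫ α : Circle, ((α : ℂ)⁻¹) ^ n ∂μ)) 0 := by
    intro μ _
    rw [hasFPowerSeriesAt_iff]
    filter_upwards [ball_mem_nhds (0:ℂ) one_pos] with z hz
    simpa [FormalMultilinearSeries.coeff_ofScalars] using hasSum_aux μ hz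
  have := (hps μ).eq_formalMultilinearSeries_of_eventually (hps ν) (by
    filter_upwards [ball_mem_nhds (0:ℂ) one_pos] with z hz
    rw [key μ z hz, key ν z hz, h z hz, h 0 (by simp)])
  have h2 := congrArg (fun p => FormalMultilinearSeries.coeff p n) this
  simpa [FormalMultilinearSeries.coeff_ofScalars] using h2

lemma moments_zpow (μ ν : Measure Circle) [IsFiniteMeasure μ] [IsFiniteMeasure ν]
    (h : ∀ n : ℕ, ∫ α : Circle, ((α : ℂ)⁻¹) ^ n ∂μ = ∫ α : Circle, ((α : ℂ)⁻¹) ^ n ∂ν) (n : ℤ) :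
    ∫ α : Circle, (α : ℂ) ^ n ∂μ = ∫ α : Circle, (α : ℂ) ^ n ∂ν := by
  obtain ⟨k, rfl | rfl⟩ := n.eq_nat_or_neg
  · have := congrArg (starRingEnd ℂ) (h k)
    rw [← integral_conj, ← integral_conj] at this
    simpa [← Circle.coe_inv_eq_conj] using this
  · simpa using h k

lemma meas_ext (μ ν : Measure Circle) [IsFiniteMeasure μ] [IsFiniteMeasure ν]
    (h : ∀ n : ℤ, ∫ α : Circle, (α : ℂ) ^ n ∂μ = ∫ α : Circle, (α : ℂ) ^ n ∂ν) : μ = ν := by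
  let e : BoundedContinuousFunction Circle ℂ :=
    BoundedContinuousFunction.mkOfCompact ⟨fun α => (α : ℂ), by fun_prop⟩
  refine ext_of_forall_mem_subalgebra_integral_eq_of_pseudoEMetric_complete_countable
    (A := StarAlgebra.adjoin ℂ {e}) ?_ ?_
  · intro x y hxy
    refine ⟨_, ⟨_, ⟨e, StarAlgebra.subset_adjoin ℂ _ rfl, rfl⟩, rfl⟩, ?_⟩
    intro h
    exact hxy (Circle.ext h)
  · intro g hg
    have hg' : g ∈ Subalgebra.toSubmodule (Algebra.adjoin ℂ ({e} ∪ star {e})) := hg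
    rw [Algebra.adjoin_eq_span] at hg'
    induction hg' using Submodule.span_induction with
    | mem x hx =>
      have : ∃ n : ℤ, ∀ α : Circle, x α = (α : ℂ) ^ n := by
        clear hg
        induction hx using Submonoid.closure_induction with
        | mem x hx =>
          rcases hx with hx | hx
          · rw [Set.mem_singleton_iff] at hx
            subst hx
            exact ⟨1, fun α => (zpow_one (α : ℂ)).symm⟩
          · rw [Set.star_singleton, Set.mem_singleton_iff] at hx
            subst hx
            exact ⟨-1, fun α => by
              rw [zpow_neg_one, ← Circle.coe_inv, Circle.coe_inv_eq_conj]; rfl⟩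
        | one => exact ⟨0, fun α => by simp⟩
        | mul x y _ _ hx hy =>
          obtain ⟨n, hn⟩ := hx
          obtain ⟨m, hm⟩ := hy
          exact ⟨n + m, fun α => by simp [hn, hm, zpow_add₀ (Circle.coe_ne_zero α)]⟩
      obtain ⟨n, hn⟩ := this
      simp_rw [hn]
      exact h n
    | zero => simp
    | add x y hx hy h1 h2 =>
      simp only [BoundedContinuousFunction.coe_add, Pi.add_apply]
      rw [integral_add (circ_integrable _ x.continuous) (circ_integrable _ y.continuous),
        integral_add (circ_integrable _ x.continuous) (circ_integrable _ y.continuous)]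
      rw [h1 (by
        change x ∈ Subalgebra.toSubmodule (Algebra.adjoin ℂ ({e} ∪ star {e}))
        rwa [Algebra.adjoin_eq_span]), h2 (by
        change y ∈ Subalgebra.toSubmodule (Algebra.adjoin ℂ ({e} ∪ star {e}))
        rwa [Algebra.adjoin_eq_span])]
    | smul c x hx h1 =>
      simp only [BoundedContinuousFunction.coe_smul, integral_smul]
      rw [h1 (by
        change x ∈ Subalgebra.toSubmodule (Algebra.adjoin ℂ ({e} ∪ star {e}))
        rwa [Algebra.adjoin_eq_span])]

end Aux

theorem herglotz_representation
    (f : ℂ → ℂ) (hf : DifferentiableOn ℂ f (Metric.ball 0 1))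
    (hre : ∀ z ∈ Metric.ball (0 : ℂ) 1, 0 ≤ (f z).re) :
    ∃ μ : Measure Circle, IsFiniteMeasure μ ∧
      (∀ z ∈ Metric.ball (0 : ℂ) 1,
        f z = Complex.I * (f 0).im + ∫ α : Circle, ((α : ℂ) + z) / ((α : ℂ) - z) ∂μ) ∧
      (∀ ν : Measure Circle, IsFiniteMeasure ν →
        (∀ z ∈ Metric.ball (0 : ℂ) 1,
          f z = Complex.I * (f 0).im + ∫ α : Circle, ((α : ℂ) + z) / ((α : ℂ) - z) ∂ν) →
        ν = μ) ∧
      (f 0 = 1 → IsProbabilityMeasure μ) := by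
  obtain ⟨μ, hμ, hrep⟩ := exists_repr f hf hre
  refine ⟨μ, hμ, hrep, fun ν hν hνrep => ?_, fun h0 => ?_⟩
  · refine meas_ext ν μ (moments_zpow ν μ (moments ν μ fun z hz => ?_))
    exact add_left_cancel ((hνrep z hz).symm.trans (hrep z hz))
  · have := mass_eq f μ hrep
    rw [h0] at this
    refine ⟨?_⟩
    rw [← ENNReal.toReal_eq_one_iff]
    simpa [Measure.real] using this
end
end

section
/- Let ℰ and K be complex Hilbert spaces and let A ∈ B(ℰ), B ∈ B(K, ℰ), C ∈ B(ℰ, K), D ∈ B(K) satisfy D*D = DD* = I_K, D*C = B*, and C*C = BB* = A + A*. Let S, T ∈ B(K) with ‖S‖ < 1 and ‖T‖ < 1. Then the operators I − DS, I − DT, I − SD and I − D*T* are invertible, and (A + BS(I − DS)^{-1}C) + (A + BT(I − DT)^{-1}C)* = B(I − SD)^{-1}(I − ST*)(I − D*T*)^{-1}B*. -/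
open scoped ComplexOrder
open ContinuousLinearMap MeasureTheory

noncomputable section

theorem aux_push {R : Type*} [Ring R] (s d : R) (h1 : IsUnit (1 - d * s)) (h2 : IsUnit (1 - s * d)) :
    s * Ring.inverse (1 - d * s) * d = Ring.inverse (1 - s * d) - 1 := by
  apply h2.mul_left_cancel
  have e : (1 - s * d) * s = s * (1 - d * s) := by noncomm_ring
  rw [mul_sub, Ring.mul_inverse_cancel _ h2, ← mul_assoc, ← mul_assoc, e, mul_assoc s,
    Ring.mul_inverse_cancel _ h1]
  noncomm_ring

theorem aux_sum {R : Type*} [Ring R] (s d d' t : R) (hd : d * d' = 1)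
    (h1 : IsUnit (1 - s * d)) (h2 : IsUnit (1 - d' * t)) :
    1 + (Ring.inverse (1 - s * d) - 1) + (Ring.inverse (1 - d' * t) - 1) =
      Ring.inverse (1 - s * d) * ((1 - s * t) * Ring.inverse (1 - d' * t)) := by
  apply h1.mul_left_cancel
  apply h2.mul_right_cancel
  have e1 := Ring.mul_inverse_cancel _ h1
  have e2 := Ring.inverse_mul_cancel _ h2
  generalize Ring.inverse (1 - s * d) = X at *
  generalize Ring.inverse (1 - d' * t) = Y at *
  have e3 : s * d * (d' * t) = s * t := by
    rw [mul_assoc, ← mul_assoc d, hd, one_mul]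
  calc _ = ((1 - s * d) * X) * (1 - d' * t) + (1 - s * d) * (Y * (1 - d' * t))
        - (1 - s * d) * (1 - d' * t) := by noncomm_ring
    _ = 1 - s * d * (d' * t) := by rw [e1, e2]; noncomm_ring
    _ = ((1 - s * d) * X) * (1 - s * t) * (Y * (1 - d' * t)) := by rw [e1, e2, e3]; noncomm_ring
    _ = _ := by noncomm_ring

theorem aux_unit {R : Type*} [NormedRing R] [HasSummableGeomSeries R] (a b : R)
    (ha : ‖a‖ ≤ 1) (hb : ‖b‖ < 1) : IsUnit (1 - a * b) ∧ IsUnit (1 - b * a) := by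
  constructor
  · apply isUnit_one_sub_of_norm_lt_one
    calc _ ≤ ‖a‖ * ‖b‖ := norm_mul_le _ _
      _ < 1 := by nlinarith [norm_nonneg a, norm_nonneg b]
  · apply isUnit_one_sub_of_norm_lt_one
    calc _ ≤ ‖b‖ * ‖a‖ := norm_mul_le _ _
      _ < 1 := by nlinarith [norm_nonneg a, norm_nonneg b]

theorem colligation_identity
    {𝓔 K : Type*}
    [NormedAddCommGroup 𝓔] [InnerProductSpace ℂ 𝓔] [CompleteSpace 𝓔]
    [NormedAddCommGroup K] [InnerProductSpace ℂ K] [CompleteSpace K]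
    (A : 𝓔 →L[ℂ] 𝓔) (B : K →L[ℂ] 𝓔) (C : 𝓔 →L[ℂ] K) (D : K →L[ℂ] K)
    (hD1 : ContinuousLinearMap.adjoint D ∘L D = 1)
    (hD2 : D ∘L ContinuousLinearMap.adjoint D = 1)
    (hDC : ContinuousLinearMap.adjoint D ∘L C = ContinuousLinearMap.adjoint B)
    (hCC : ContinuousLinearMap.adjoint C ∘L C = A + ContinuousLinearMap.adjoint A)
    (hBB : B ∘L ContinuousLinearMap.adjoint B = A + ContinuousLinearMap.adjoint A)
    (S T : K →L[ℂ] K) (hS : ‖S‖ < 1) (hT : ‖T‖ < 1) :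
    IsUnit (1 - D ∘L S) ∧ IsUnit (1 - D ∘L T) ∧ IsUnit (1 - S ∘L D) ∧
    IsUnit (1 - ContinuousLinearMap.adjoint D ∘L ContinuousLinearMap.adjoint T) ∧
    (A + B ∘L S ∘L Ring.inverse (1 - D ∘L S) ∘L C) +
        ContinuousLinearMap.adjoint (A + B ∘L T ∘L Ring.inverse (1 - D ∘L T) ∘L C)
      = B ∘L Ring.inverse (1 - S ∘L D) ∘L
          (1 - S ∘L ContinuousLinearMap.adjoint T) ∘L
          Ring.inverse (1 - ContinuousLinearMap.adjoint D ∘L ContinuousLinearMap.adjoint T) ∘L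
          ContinuousLinearMap.adjoint B := by
  have hDn : ‖D‖ ≤ 1 := by
    have h := ContinuousLinearMap.norm_adjoint_comp_self D
    rw [hD1] at h
    have h1 : ‖(1 : K →L[ℂ] K)‖ ≤ 1 := ContinuousLinearMap.norm_id_le
    nlinarith [norm_nonneg D]
  have hDn' : ‖adjoint D‖ ≤ 1 := by rwa [LinearIsometryEquiv.norm_map]
  have hT' : ‖adjoint T‖ < 1 := by rwa [LinearIsometryEquiv.norm_map]
  obtain ⟨u1, u3⟩ := aux_unit D S hDn hS
  obtain ⟨u2, -⟩ := aux_unit D T hDn hT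
  obtain ⟨u4, u5⟩ := aux_unit (adjoint D) (adjoint T) hDn' hT'
  refine ⟨u1, u2, u3, u4, ?_⟩
  have hC : C = D ∘L adjoint B := by
    rw [← hDC, ← ContinuousLinearMap.comp_assoc, hD2]; rfl
  have hinv : adjoint (Ring.inverse (1 - D ∘L T)) = Ring.inverse (1 - adjoint T * adjoint D) := by
    have h := Ring.inverse_star (1 - D * T)
    rw [star_sub, star_one, star_mul] at h
    exact h.symm
  have k1 := aux_push S D u1 u3
  have k2 := aux_push (adjoint D) (adjoint T) u5 u4
  have k3 := aux_sum S D (adjoint D) (adjoint T) hD2 u3 u4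
  rw [← k1, ← k2] at k3
  have k4 := congrArg (fun X : K →L[ℂ] K => B ∘L X ∘L adjoint B) k3
  have hl : (A + B ∘L S ∘L Ring.inverse (1 - D ∘L S) ∘L C) +
        adjoint (A + B ∘L T ∘L Ring.inverse (1 - D ∘L T) ∘L C) =
      B ∘L (1 + S * Ring.inverse (1 - D * S) * D
        + adjoint D * Ring.inverse (1 - adjoint T * adjoint D) * adjoint T) ∘L adjoint B := by
    rw [map_add]
    simp only [adjoint_comp, hinv]
    rw [add_add_add_comm, ← hBB, hC]
    simp only [adjoint_comp, adjoint_adjoint]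
    ext x
    simp [add_assoc]
    rfl
  rw [hl]
  exact k4
end
end
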